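/- (Derivability of Primitive Chop Formulas in Grammar) Fix a binary relation R on State, a recursion variable X, and a chop formula Ψ = ⋁_{1≤j≤n} φ_j ∈ CF_{(R,X)}. Define C⁰ = ∅ and C^{i+1} = ⋃_{1≤j≤n} { φ_j with each occurrence of X replaced by some (possibly different) element of C^i }. Then ⋃_{i≥0} grammatize(C^i) = L(gr(Ψ)), i.e. the words of the primitive chop formulas generated by iterating the substitution are exactly the words derivable in the grammar gr(Ψ). -/

import Mathlib

/-- A trace is a nonempty finite list of states (an element of `State⁺`). -/
abbrev Trace (State : Type) : Type := {l : List State // l ≠ []}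

/-- Trace formulas: `Φ ::= p | R | Φ∧Φ | Φ∨Φ | Φ⌢Φ | X | μX.Φ`. -/
inductive TF (State RVar : Type) : Type where
  | pred : (State → Prop) → TF State RVar
  | rel  : (State → State → Prop) → TF State RVar
  | conj : TF State RVar → TF State RVar → TF State RVar
  | disj : TF State RVar → TF State RVar → TF State RVar
  | chop : TF State RVar → TF State RVar → TF State RVar
  | var  : RVar → TF State RVar
  | mu   : RVar → TF State RVar → TF State RVar

/-- Chop of trace sets: `A ⋈ B = {σ·s·σ' | σ·s ∈ A ∧ s·σ' ∈ B}`,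
the two parts overlapping in the single shared state `s`. -/
def chopSet {State : Type} (A B : Set (Trace State)) : Set (Trace State) :=
  {t | ∃ (σ σ' : List State) (s : State),
    t.1 = σ ++ s :: σ' ∧
    (⟨σ ++ [s], by simp⟩ : Trace State) ∈ A ∧
    (⟨s :: σ', by simp⟩ : Trace State) ∈ B}

/-- Semantics of trace formulas under a valuation `V : RVar → 𝒫(State⁺)`. -/
def sem {State RVar : Type} [DecidableEq RVar] :
    TF State RVar → (RVar → Set (Trace State)) → Set (Trace State)
  | TF.pred p, _ => {t | ∃ (s : State) (σ : List State), t.1 = s :: σ ∧ p s}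
  | TF.rel R, _ => {t | ∃ s s', t.1 = [s, s'] ∧ R s s'}
  | TF.conj a b, V => sem a V ∩ sem b V
  | TF.disj a b, V => sem a V ∪ sem b V
  | TF.chop a b, V => chopSet (sem a V) (sem b V)
  | TF.var X, V => V X
  | TF.mu X a, V => ⋂₀ {γ : Set (Trace State) | sem a (Function.update V X γ) ⊆ γ}

/-- Atoms of primitive chop formulas over a fixed relation `R`
and recursion variable `X`: either `R` or `X`. A primitive chop formula
`S₁⌢…⌢S_k` is a (nonempty) list of atoms; since `grammatize` sends it to
the word `S₁S₂⋯S_k` over terminal `R` and nonterminal `X`, words of the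
grammar are lists of atoms as well. -/
inductive Atom : Type where
  | r : Atom
  | x : Atom
deriving DecidableEq

/-- The trace formula denoted by an atom. -/
def Atom.toTF {State RVar : Type} (R : State → State → Prop) (X : RVar) :
    Atom → TF State RVar
  | Atom.r => TF.rel R
  | Atom.x => TF.var X

/-- The trace formula `S₁⌢…⌢S_k` denoted by a primitive chop formula
(the empty list is mapped to a junk formula with empty semantics). -/
def pcfToTF {State RVar : Type} (R : State → State → Prop) (X : RVar) :
    List Atom → TF State RVar
  | [] => TF.pred fun _ => False
  | [a] => a.toTF R X
  | a :: b :: rest => TF.chop (a.toTF R X) (pcfToTF R X (b :: rest))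

/-- The trace formula `⋁_{1≤j≤n} φ_j` denoted by a chop formula, i.e. by a
finite disjunction of primitive chop formulas. -/
def cfToTF {State RVar : Type} (R : State → State → Prop) (X : RVar) :
    List (List Atom) → TF State RVar
  | [] => TF.pred fun _ => False
  | [c] => pcfToTF R X c
  | c :: d :: rest => TF.disj (pcfToTF R X c) (cfToTF R X (d :: rest))

/-- `SubstX S φ ψ`: `ψ` is obtained from `φ` by replacing each occurrence of
the atom `X` by some (possibly different) element of `S`. -/
inductive SubstX (S : Set (List Atom)) : List Atom → List Atom → Prop where
  | nil : SubstX S [] []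
  | r {φ ψ : List Atom} : SubstX S φ ψ → SubstX S (Atom.r :: φ) (Atom.r :: ψ)
  | x {φ ψ : List Atom} (c : List Atom) :
      c ∈ S → SubstX S φ ψ → SubstX S (Atom.x :: φ) (c ++ ψ)

/-- Derivability of sentential forms in the grammar `gr(Ψ)` with single
nonterminal `X`, single terminal `R`, initial nonterminal `X`, and one
production `X → S₁⋯S_k` for each disjunct `S₁⌢…⌢S_k` of `Ψ`. -/
inductive Derives (Ψ : List (List Atom)) : List Atom → Prop where
  | start : Derives Ψ [Atom.x]
  | step {u v c : List Atom} :
      c ∈ Ψ → Derives Ψ (u ++ Atom.x :: v) → Derives Ψ (u ++ c ++ v)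

/-- `L(gr(Ψ)) ⊆ {R}*`: the terminal words derivable from `X` in `gr(Ψ)`. -/
def Lang (Ψ : List (List Atom)) : Set (List Atom) :=
  {w | Derives Ψ w ∧ Atom.x ∉ w}

/-- `grammatize` sends a primitive chop formula `S₁⌢…⌢S_k` to the word
`S₁S₂⋯S_k`; under our encoding of chop sequences as lists of atoms it is the
identity map. -/
def grammatize : List Atom → List Atom := id

theorem SubstX.mono {S T : Set (List Atom)} (hST : S ⊆ T) {φ ψ : List Atom}
    (h : SubstX S φ ψ) : SubstX T φ ψ := by
  induction h with
  | nil => exact .nil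
  | r _ ih => exact .r ih
  | x c hc _ ih => exact .x c (hST hc) ih

theorem SubstX.append {S : Set (List Atom)} {a b a2 b2 : List Atom}
    (h : SubstX S a a2) (h2 : SubstX S b b2) : SubstX S (a ++ b) (a2 ++ b2) := by
  induction h with
  | nil => exact h2
  | r _ ih => exact .r ih
  | x c hc _ ih =>
    rw [List.append_assoc]
    exact .x c hc ih

theorem SubstX.split {S : Set (List Atom)} (a b : List Atom) (w : List Atom)
    (h : SubstX S (a ++ b) w) :
    ∃ w1 w2, w = w1 ++ w2 ∧ SubstX S a w1 ∧ SubstX S b w2 := by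
  induction a generalizing w with
  | nil => exact ⟨[], w, rfl, .nil, h⟩
  | cons s a ih =>
    rw [List.cons_append] at h
    cases h with
    | r h =>
      obtain ⟨w1, w2, rfl, h1, h2⟩ := ih _ h
      exact ⟨_, w2, rfl, .r h1, h2⟩
    | x c hc h =>
      obtain ⟨w1, w2, rfl, h1, h2⟩ := ih _ h
      exact ⟨c ++ w1, w2, by simp, .x c hc h1, h2⟩

theorem SubstX.self {S : Set (List Atom)} (w : List Atom) (h : Atom.x ∉ w) :
    SubstX S w w := by
  induction w with
  | nil => exact .nil
  | cons s w ih =>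
    cases s with
    | r => exact .r (ih (by simp at h; exact h))
    | x => simp at h

theorem SubstX.derives {Ψ : List (List Atom)} {S : Set (List Atom)}
    (hS : ∀ c ∈ S, ∀ u v, Derives Ψ (u ++ Atom.x :: v) → Derives Ψ (u ++ c ++ v))
    {φ ψ : List Atom} (h : SubstX S φ ψ) :
    ∀ u v, Derives Ψ (u ++ φ ++ v) → Derives Ψ (u ++ ψ ++ v) := by
  induction h with
  | nil => exact fun _ _ h => h
  | r _ ih =>
    intro u v h
    have := ih (u ++ [Atom.r]) v (by simpa using h)
    simpa using this
  | @x φ ψ c hc _ ih =>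
    intro u v h
    have h1 := hS c hc u (φ ++ v) (by simpa using h)
    have := ih (u ++ c) v (by simpa using h1)
    simpa using this

theorem SubstX.no_x {S : Set (List Atom)} (hS : ∀ c ∈ S, Atom.x ∉ c)
    {φ ψ : List Atom} (h : SubstX S φ ψ) : Atom.x ∉ ψ := by
  induction h with
  | nil => simp
  | r _ ih => simpa using ih
  | x c hc _ ih => simpa using ⟨hS c hc, ih⟩

theorem SubstX.exists_stage {C : ℕ → Set (List Atom)} (hC : Monotone C)
    {φ ψ : List Atom} (h : SubstX (⋃ i, C i) φ ψ) : ∃ i, SubstX (C i) φ ψ := by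
  induction h with
  | nil => exact ⟨0, .nil⟩
  | r _ ih => exact ih.imp fun _ h => .r h
  | x c hc _ ih =>
    obtain ⟨i, hi⟩ := ih
    obtain ⟨j, hj⟩ := Set.mem_iUnion.1 hc
    exact ⟨max i j, .x c (hC (le_max_right i j) hj) (hi.mono (hC (le_max_left i j)))⟩

/-- Derivability of Primitive Chop Formulas in Grammar:
with `C⁰ = ∅` and
`C^{i+1} = ⋃_j {φ_j with each occurrence of X replaced by some element of C^i}`,
one has `⋃_{i≥0} grammatize(C^i) = L(gr(Ψ))`. -/
theorem pcf_iter_eq_lang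
    (Ψ : List (List Atom)) (hΨ : Ψ ≠ []) (hpcf : ∀ c ∈ Ψ, c ≠ [])
    (C : ℕ → Set (List Atom))
    (hC0 : C 0 = ∅)
    (hCs : ∀ i, C (i + 1) = {ψ' | ∃ φ ∈ Ψ, SubstX (C i) φ ψ'}) :
    (⋃ i, grammatize '' C i) = Lang Ψ := by
  have himg : (⋃ i, grammatize '' C i) = ⋃ i, C i := by
    simp [grammatize]
  rw [himg]
  have hmono : Monotone C := by
    apply monotone_nat_of_le_succ
    intro i
    induction i with
    | zero => simp [hC0]
    | succ i ih =>
      rw [hCs i, hCs (i + 1)]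
      rintro w ⟨φ, hφ, h⟩
      exact ⟨φ, hφ, h.mono ih⟩
  have hsound : ∀ i, ∀ w ∈ C i,
      (∀ u v, Derives Ψ (u ++ Atom.x :: v) → Derives Ψ (u ++ w ++ v)) ∧ Atom.x ∉ w := by
    intro i
    induction i with
    | zero => simp [hC0]
    | succ i ih =>
      rw [hCs i]
      rintro w ⟨φ, hφ, h⟩
      exact ⟨fun u v hd => h.derives (fun c hc => (ih c hc).1) u v (.step hφ hd),
        h.no_x fun c hc => (ih c hc).2⟩
  have hcomp : ∀ s, Derives Ψ s → ∀ w, SubstX (⋃ i, C i) s w → w ∈ ⋃ i, C i := by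
    intro s hs
    induction hs with
    | start =>
      intro w hw
      cases hw with
      | x c hc h =>
        cases h
        simpa using hc
    | @step u v c hc _ ih =>
      intro w hw
      obtain ⟨w1, w2, rfl, h1, h2⟩ := SubstX.split _ _ _ hw
      obtain ⟨w3, w4, rfl, h3, h4⟩ := SubstX.split _ _ _ h1
      obtain ⟨i, hi⟩ := h4.exists_stage hmono
      have hmem : w4 ∈ ⋃ i, C i := by
        refine Set.mem_iUnion.2 ⟨i + 1, ?_⟩
        rw [hCs i]
        exact ⟨c, hc, hi⟩
      apply ih
      rw [List.append_assoc]
      exact h3.append (.x w4 hmem h2)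
  ext w
  constructor
  · intro hw
    obtain ⟨i, hi⟩ := Set.mem_iUnion.1 hw
    obtain ⟨h1, h2⟩ := hsound i w hi
    exact ⟨by simpa using h1 [] [] .start, h2⟩
  · rintro ⟨h1, h2⟩
    exact hcomp w h1 w (SubstX.self w h2)
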